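/- (Uninterrupted Opening Theorem) Assume WaitTime ≥ d_open, that is, d_min ≥ d_close + d_open. In a regular run, the opening of the gate is not interrupted: if Dir is set to open at some moment α (i.e., Dir(α) = close and Dir(α+) = open), then Dir(t) = open for every t in the interval (α, α + d_open). -/

import Mathlib

namespace RailCross

inductive TStat : Type
  | emp | coming | incrossing
deriving DecidableEq

inductive DirV : Type
  | opn | cls
deriving DecidableEq

inductive GateV : Type
  | opened | closed
deriving DecidableEq

/-- `f` is piecewise constant on `[0, ∞)`: for every `τ > 0` there is a finite
partition `0 = s 0 < s 1 < … < s n = τ` such that `f` is constant on each open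
subinterval `(s i, s (i+1))`. -/
def PWC {Y : Type*} (f : ℝ → Y) : Prop :=
  ∀ τ : ℝ, 0 < τ → ∃ n : ℕ, ∃ s : ℕ → ℝ,
    s 0 = 0 ∧ s n = τ ∧ (∀ i < n, s i < s (i + 1)) ∧
    (∀ i < n, ∀ a b : ℝ, s i < a → a < b → b < s (i + 1) → f a = f b)

/-- `v` is the right-hand value `f(t+)`: `f` is constantly `v` on some `(t, t+ε)`. -/
def RightVal {Y : Type*} (f : ℝ → Y) (t : ℝ) (v : Y) : Prop :=
  ∃ ε : ℝ, 0 < ε ∧ ∀ u : ℝ, t < u → u < t + ε → f u = v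

/-- `v` is the left-hand value `f(t−)` (for `t > 0`): `f` is constantly `v` on some `(t-ε, t)`. -/
def LeftVal {Y : Type*} (f : ℝ → Y) (t : ℝ) (v : Y) : Prop :=
  ∃ ε : ℝ, 0 < ε ∧ ε ≤ t ∧ ∀ u : ℝ, t - ε < u → u < t → f u = v

/-- `tm` is the (finite or infinite) increasing sequence of significant moments of a
track with status function `f`; a finite sequence is encoded by letting `tm` take the
value `⊤ = ∞` from some point on. -/
structure TrainMotion (dmin dmax : ℝ) (f : ℝ → TStat) (tm : ℕ → EReal) : Prop where
  zero : tm 0 = 0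
  mono : Monotone tm
  strict : ∀ i, tm i ≠ ⊤ → tm i < tm (i + 1)
  last_div : ∀ k, tm k ≠ ⊤ → tm (k + 1) = ⊤ → 3 ∣ k
  status_empty : ∀ i : ℕ, ∀ u : ℝ, tm (3 * i) ≤ (u : EReal) → (u : EReal) < tm (3 * i + 1) →
    f u = TStat.emp
  status_coming : ∀ i : ℕ, ∀ u : ℝ, tm (3 * i + 1) ≤ (u : EReal) → (u : EReal) < tm (3 * i + 2) →
    f u = TStat.coming
  status_cross : ∀ i : ℕ, ∀ u : ℝ, tm (3 * i + 2) ≤ (u : EReal) → (u : EReal) < tm (3 * i + 3) →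
    f u = TStat.incrossing
  gap : ∀ i : ℕ, ∀ a b : ℝ, tm (3 * i + 1) = (a : EReal) → tm (3 * i + 2) = (b : EReal) →
    dmin ≤ b - a ∧ b - a ≤ dmax

/-- `SafeToOpen(t)`: every track is empty or its deadline is more than `dopen` away. -/
def SafeToOpen {Tracks : Type*} (dopen : ℝ) (trackStatus : Tracks → ℝ → TStat)
    (deadline : Tracks → ℝ → EReal) (t : ℝ) : Prop :=
  ∀ x : Tracks, trackStatus x t = TStat.emp ∨ ((t + dopen : ℝ) : EReal) < deadline x t

/-- A regular run of the railroad-crossing evolving algebra.  `WaitTime = dmin - dclose`. -/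
structure RegularRun (Tracks : Type*) (dmin dmax dopen dclose : ℝ) where
  trackStatus : Tracks → ℝ → TStat
  deadline : Tracks → ℝ → EReal
  dir : ℝ → DirV
  gate : ℝ → GateV
  /-- the right-hand value `Deadline(x, t+)` -/
  deadlinePlus : Tracks → ℝ → EReal
  /-- the right-hand value `Dir(t+)` -/
  dirPlus : ℝ → DirV
  /-- the right-hand value `GateStatus(t+)` -/
  gatePlus : ℝ → GateV
  pwc_ts : ∀ x, PWC (trackStatus x)
  pwc_dl : ∀ x, PWC (deadline x)
  pwc_dir : PWC dir
  pwc_gate : PWC gate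
  dlPlus_spec : ∀ x, ∀ t : ℝ, 0 ≤ t → RightVal (deadline x) t (deadlinePlus x t)
  dirPlus_spec : ∀ t : ℝ, 0 ≤ t → RightVal dir t (dirPlus t)
  gatePlus_spec : ∀ t : ℝ, 0 ≤ t → RightVal gate t (gatePlus t)
  dl_left : ∀ x, ∀ t : ℝ, 0 < t → LeftVal (deadline x) t (deadline x t)
  dir_left : ∀ t : ℝ, 0 < t → LeftVal dir t (dir t)
  gate_left : ∀ t : ℝ, 0 < t → LeftVal gate t (gate t)
  trainMotion : ∀ x, ∃ tm : ℕ → EReal, TrainMotion dmin dmax (trackStatus x) tm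
  dl_init : ∀ x, deadline x 0 = ⊤
  dir_init : dir 0 = DirV.opn
  gate_init : gate 0 = GateV.opened
  dl_step_coming : ∀ x, ∀ t : ℝ, 0 ≤ t → trackStatus x t = TStat.coming → deadline x t = ⊤ →
    deadlinePlus x t = ((t + (dmin - dclose) : ℝ) : EReal)
  dl_step_empty : ∀ x, ∀ t : ℝ, 0 ≤ t → trackStatus x t = TStat.emp → deadline x t ≠ ⊤ →
    deadlinePlus x t = ⊤
  dl_step_other : ∀ x, ∀ t : ℝ, 0 ≤ t →
    ¬(trackStatus x t = TStat.coming ∧ deadline x t = ⊤) →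
    ¬(trackStatus x t = TStat.emp ∧ deadline x t ≠ ⊤) →
    deadlinePlus x t = deadline x t
  dir_step_close : ∀ t : ℝ, 0 ≤ t → (∃ x, deadline x t = (t : EReal)) → dirPlus t = DirV.cls
  dir_step_open : ∀ t : ℝ, 0 ≤ t → (∀ x, deadline x t ≠ (t : EReal)) → dir t = DirV.cls →
    SafeToOpen dopen trackStatus deadline t → dirPlus t = DirV.opn
  dir_step_other : ∀ t : ℝ, 0 ≤ t → (∀ x, deadline x t ≠ (t : EReal)) →
    ¬(dir t = DirV.cls ∧ SafeToOpen dopen trackStatus deadline t) → dirPlus t = dir t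
  gate_step : ∀ t : ℝ, 0 ≤ t →
    gatePlus t = gate t ∨ (dir t = DirV.opn ∧ gatePlus t = GateV.opened) ∨
      (dir t = DirV.cls ∧ gatePlus t = GateV.closed)
  gate_close_bound : ∀ t : ℝ, 0 ≤ t →
    ¬(∀ u ∈ Set.Ioo t (t + dclose), dir u = DirV.cls ∧ gate u = GateV.opened)
  gate_open_bound : ∀ t : ℝ, 0 ≤ t →
    ¬(∀ u ∈ Set.Ioo t (t + dopen), dir u = DirV.opn ∧ gate u = GateV.closed)

/-- Continuous induction along a left-continuous function with right-hand values: a property of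
values that holds just after `a` and persists to right-hand values holds throughout `(a, b)`. -/
theorem forall_Ioo_of_leftVal_of_rightVal {Y : Type*} {f g : ℝ → Y} {P : Y → Prop} {a b : ℝ}
    (ha : 0 ≤ a) (hright : ∀ t, 0 ≤ t → RightVal f t (g t))
    (hleft : ∀ t, 0 < t → LeftVal f t (f t)) (hstart : P (g a))
    (hstep : ∀ t ∈ Set.Ioo a b, P (f t) → P (g t)) :
    ∀ t ∈ Set.Ioo a b, P (f t) := by
  by_contra! hcon
  obtain ⟨t₀, ht₀, hPt₀⟩ := hcon
  set S : Set ℝ := {u | u ∈ Set.Ioo a b ∧ ¬ P (f u)}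
  have hne : S.Nonempty := ⟨t₀, ht₀, hPt₀⟩
  have hbdd : BddBelow S := ⟨a, fun u hu => hu.1.1.le⟩
  obtain ⟨ε, hε, hfε⟩ := hright a ha
  have hac : a + ε ≤ sInf S := by
    refine le_csInf hne fun u hu => ?_
    by_contra! hlt
    exact hu.2 (hfε u hu.1.1 hlt ▸ hstart)
  have hcb : sInf S < b := (csInf_le hbdd ⟨ht₀, hPt₀⟩).trans_lt ht₀.2
  have hbelow : ∀ u, a < u → u < sInf S → P (f u) := by
    intro u hau huc
    by_contra hPu
    exact (csInf_le hbdd ⟨⟨hau, huc.trans hcb⟩, hPu⟩).not_gt huc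
  obtain ⟨δ, hδ, -, hfδ⟩ := hleft (sInf S) (by linarith)
  have hPc : P (f (sInf S)) := by
    obtain ⟨u, hu, huc⟩ := exists_between (max_lt (by linarith) (by linarith) :
      max a (sInf S - δ) < sInf S)
    exact hfδ u ((le_max_right _ _).trans_lt hu) huc ▸
      hbelow u ((le_max_left _ _).trans_lt hu) huc
  obtain ⟨η, hη, hfη⟩ := hright (sInf S) (by linarith)
  obtain ⟨u, hu, huη⟩ := exists_lt_of_csInf_lt hne (by linarith : sInf S < sInf S + η)
  rcases (csInf_le hbdd hu).eq_or_lt with h | h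
  · exact hu.2 (h ▸ hPc)
  · exact hu.2 (hfη u h huη ▸ hstep _ ⟨by linarith, hcb⟩ hPc)

theorem uninterrupted_opening {Tracks : Type*} [Fintype Tracks] [Nonempty Tracks]
    {dmin dmax dopen dclose : ℝ}
    (hdmin : 0 < dmin) (hdmax : 0 < dmax) (hdopen : 0 < dopen) (hdclose : 0 < dclose)
    (hcm : dclose < dmin) (hmm : dmin ≤ dmax)
    (R : RegularRun Tracks dmin dmax dopen dclose)
    (hWT : dclose + dopen ≤ dmin)
    (α : ℝ) (hα : 0 ≤ α)
    (h1 : R.dir α = DirV.cls) (h2 : R.dirPlus α = DirV.opn) :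
    ∀ t ∈ Set.Ioo α (α + dopen), R.dir t = DirV.opn := by
  have hnot : ∀ x, R.deadline x α ≠ (α : EReal) := by
    intro x hx
    have := R.dir_step_close α hα ⟨x, hx⟩
    simp [h2] at this
  have hsafe : SafeToOpen dopen R.trackStatus R.deadline α := by
    by_contra hns
    have := R.dir_step_other α hα hnot fun h => hns h.2
    simp [h1, h2] at this
  have hdl : ∀ x, ∀ t ∈ Set.Ioo α (α + dopen),
      ((α + dopen : ℝ) : EReal) ≤ R.deadline x t := by
    intro x
    have hplus : ∀ t, α ≤ t →
        (R.trackStatus x t = TStat.emp ∨ ((α + dopen : ℝ) : EReal) ≤ R.deadline x t) →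
        ((α + dopen : ℝ) : EReal) ≤ R.deadlinePlus x t := by
      intro t ht h
      have ht0 : 0 ≤ t := hα.trans ht
      by_cases hc : R.trackStatus x t = TStat.coming ∧ R.deadline x t = ⊤
      · rw [R.dl_step_coming x t ht0 hc.1 hc.2]
        exact EReal.coe_le_coe_iff.2 (by linarith)
      by_cases he : R.trackStatus x t = TStat.emp ∧ R.deadline x t ≠ ⊤
      · rw [R.dl_step_empty x t ht0 he.1 he.2]
        exact le_top
      rw [R.dl_step_other x t ht0 hc he]
      rcases h with h | h
      · rw [not_not.1 fun h' => he ⟨h, h'⟩]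
        exact le_top
      · exact h
    exact forall_Ioo_of_leftVal_of_rightVal (P := fun d => ((α + dopen : ℝ) : EReal) ≤ d) hα
      (R.dlPlus_spec x) (R.dl_left x) (hplus α le_rfl ((hsafe x).imp_right le_of_lt))
      fun t ht h => hplus t ht.1.le (Or.inr h)
  refine forall_Ioo_of_leftVal_of_rightVal (P := fun d => d = DirV.opn) hα
    R.dirPlus_spec R.dir_left h2 fun t ht h => ?_
  rw [R.dir_step_other t (hα.trans ht.1.le) _ (by simp [h]), h]
  intro x hx
  have := hdl x t ht
  rw [hx, EReal.coe_le_coe_iff] at this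
  exact this.not_gt ht.2

end RailCross
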